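/- Let q be a prime power and t ≥ 1. There exists a set S of t-dimensional subspaces of F_q^{3t} with |S| ≥ q^{t²/3} (as a real-number inequality) such that any three distinct subspaces in S together span a subspace of F_q^{3t} of dimension at least 2t. -/

import Mathlib

open Module

/-- Union bound: if few pairs are forbidden, then some injective family in a finite group has
no forbidden pair of differences based at a common member. -/
lemma exists_injective_forall_sub_notMem {G : Type*} [AddCommGroup G] [Fintype G] [Nontrivial G]
    (N : ℕ) (P : Set (G × G)) (h0 : ∀ y, (0, y) ∈ P)
    (hcard : N * (N - 1) * (N - 2) * Nat.card P < Nat.card G ^ 2) :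
    ∃ f : Fin N → G, Function.Injective f ∧
      ∀ i j k, i ≠ j → i ≠ k → j ≠ k → (f i - f j, f i - f k) ∉ P := by
  classical
  rcases Nat.lt_or_ge N 3 with hN | hN
  · have h2 : Fintype.card (Fin N) ≤ Fintype.card G := by
      have := Fintype.one_lt_card (α := G)
      simp only [Fintype.card_fin]
      omega
    obtain ⟨f⟩ := Function.Embedding.nonempty_of_card_le h2
    refine ⟨f, f.injective, fun i j k hij hik hjk => ?_⟩
    omega
  let T : Finset (Fin N × Fin N × Fin N) :=
    Finset.univ.filter fun x => x.1 ≠ x.2.1 ∧ x.1 ≠ x.2.2 ∧ x.2.1 ≠ x.2.2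
  have hT : T.card ≤ N * (N - 1) * (N - 2) := by
    have hsub : T ⊆ ((Finset.univ : Finset (Fin N)).sigma fun i => (Finset.univ.erase i).sigma
        fun j => (Finset.univ.erase i).erase j).image fun x => (x.1, x.2.1, x.2.2) := by
      rintro ⟨i, j, k⟩ h
      simp only [T, Finset.mem_filter, Finset.mem_univ, true_and] at h
      simp only [Finset.mem_image, Finset.mem_sigma, Finset.mem_univ, true_and, Finset.mem_erase]
      exact ⟨⟨i, j, k⟩, ⟨⟨h.1.symm, trivial⟩, h.2.2.symm, h.2.1.symm, trivial⟩, rfl⟩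
    refine (Finset.card_le_card hsub).trans (Finset.card_image_le.trans (le_of_eq ?_))
    rw [Finset.card_sigma, Finset.sum_const_nat (m := (N - 1) * (N - 2)), Finset.card_univ,
      Fintype.card_fin, mul_assoc]
    intro i _
    rw [Finset.card_sigma, Finset.sum_const_nat (m := N - 2)]
    · simp [Finset.card_erase_of_mem]
    intro j hj
    rw [Finset.card_erase_of_mem hj, Finset.card_erase_of_mem (Finset.mem_univ _)]
    simp
    omega
  let B : Fin N × Fin N × Fin N → Finset (Fin N → G) := fun x =>
    Finset.univ.filter fun f => (f x.1 - f x.2.1, f x.1 - f x.2.2) ∈ P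
  have hB : ∀ x ∈ T, (B x).card ≤ Nat.card P * Nat.card G ^ (N - 2) := by
    rintro ⟨i, j, k⟩ h
    simp only [T, Finset.mem_filter, Finset.mem_univ, true_and] at h
    obtain ⟨hij, hik, hjk⟩ := h
    let φ : B (i, j, k) → P × ({m // m ∉ ({j, k} : Finset (Fin N))} → G) := fun f =>
      (⟨(f.1 i - f.1 j, f.1 i - f.1 k), (Finset.mem_filter.1 f.2).2⟩, fun m => f.1 m)
    have hφ : Function.Injective φ := by
      rintro ⟨f, hf⟩ ⟨g, hg⟩ h
      simp only [φ, Prod.mk.injEq, Subtype.mk.injEq] at h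
      obtain ⟨⟨h1, h2⟩, h3⟩ := h
      have h4 : ∀ m, m ≠ j → m ≠ k → f m = g m := fun m hj hk =>
        congrFun h3 ⟨m, by simp [hj, hk]⟩
      have hi := h4 i hij hik
      rw [hi] at h1 h2
      ext m
      by_cases hj : m = j
      · subst hj; exact sub_right_injective h1
      by_cases hk : m = k
      · subst hk; exact sub_right_injective h2
      exact h4 m hj hk
    have hle := Nat.card_le_card_of_injective φ hφ
    rw [Nat.card_prod, Nat.card_fun, Nat.card_eq_fintype_card, Fintype.card_coe] at hle
    convert hle using 3
    rw [Nat.card_eq_fintype_card, Fintype.card_subtype_compl, Fintype.card_coe,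
      Finset.card_pair hjk, Fintype.card_fin]
  have hlt : (T.biUnion B).card < (Finset.univ : Finset (Fin N → G)).card := by
    calc (T.biUnion B).card ≤ T.card * (Nat.card P * Nat.card G ^ (N - 2)) :=
          Finset.card_biUnion_le_card_mul _ _ _ hB
      _ ≤ N * (N - 1) * (N - 2) * (Nat.card P * Nat.card G ^ (N - 2)) := by gcongr
      _ = N * (N - 1) * (N - 2) * Nat.card P * Nat.card G ^ (N - 2) := by ring
      _ < Nat.card G ^ 2 * Nat.card G ^ (N - 2) :=
          Nat.mul_lt_mul_of_pos_right hcard (pow_pos Nat.card_pos _)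
      _ = (Finset.univ : Finset (Fin N → G)).card := by
          rw [← pow_add, Finset.card_univ, Fintype.card_fun, Fintype.card_fin,
            Nat.card_eq_fintype_card]
          congr 1
          omega
  obtain ⟨f, -, hf⟩ := Finset.exists_mem_notMem_of_card_lt_card hlt
  have hgood : ∀ i j k, i ≠ j → i ≠ k → j ≠ k → (f i - f j, f i - f k) ∉ P := by
    intro i j k hij hik hjk hmem
    refine hf (Finset.mem_biUnion.2 ⟨(i, j, k), ?_, ?_⟩)
    · simp [T, hij, hik, hjk]
    · simpa [B] using hmem
  refine ⟨f, fun i j hfij => ?_, hgood⟩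
  by_contra hij
  obtain ⟨k, hk⟩ : ∃ k, k ∉ ({i, j} : Finset (Fin N)) := by
    by_contra! hall
    have h1 := Finset.card_le_card (fun m _ => hall m : Finset.univ ⊆ ({i, j} : Finset (Fin N)))
    rw [Finset.card_pair hij, Finset.card_univ, Fintype.card_fin] at h1
    omega
  simp only [Finset.mem_insert, Finset.mem_singleton, not_or] at hk
  refine hgood i j k hij (Ne.symm hk.1) (Ne.symm hk.2) ?_
  rw [hfij, sub_self]
  exact h0 _

/-- The number of finite families of vectors of rank at most `r`. -/
lemma card_finrank_span_le {F W ι : Type*} [Field F] [Fintype F] [AddCommGroup W] [Module F W]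
    [Fintype W] [Fintype ι] (r : ℕ) (hr : r ≤ Fintype.card ι) :
    Nat.card {v : ι → W | finrank F (Submodule.span F (Set.range v)) ≤ r} ≤
      (Fintype.card ι).choose r *
        (Nat.card W ^ r * Nat.card F ^ (r * (Fintype.card ι - r))) := by
  classical
  let D : Finset ι → Finset (ι → W) := fun s =>
    Finset.univ.filter fun v => ∀ i, v i ∈ Submodule.span F (v '' s)
  have hsub : {v : ι → W | finrank F (Submodule.span F (Set.range v)) ≤ r} ⊆
      ((Finset.univ.powersetCard r).biUnion D : Finset (ι → W)) := by
    intro v hv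
    obtain ⟨κ, a, ha, hspan, hli⟩ := exists_linearIndependent' F v
    have : Finite κ := Finite.of_injective a ha
    have := Fintype.ofFinite κ
    have hκ : Fintype.card κ ≤ r := by
      rw [← finrank_span_eq_card hli, hspan]
      exact hv
    obtain ⟨s, hs, hsr⟩ := Finset.exists_superset_card_eq
      (s := Finset.univ.image a) (n := r) (Finset.card_image_le.trans hκ) hr
    simp only [Finset.coe_biUnion, Set.mem_iUnion, Finset.mem_coe]
    refine ⟨s, Finset.mem_powersetCard.2 ⟨Finset.subset_univ _, hsr⟩, ?_⟩
    simp only [D, Finset.mem_filter, Finset.mem_univ, true_and]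
    intro i
    have hi : v i ∈ Submodule.span F (Set.range (v ∘ a)) := by
      rw [hspan]
      exact Submodule.subset_span ⟨i, rfl⟩
    refine Submodule.span_mono ?_ hi
    rintro _ ⟨k, rfl⟩
    exact ⟨a k, hs (Finset.mem_image_of_mem _ (Finset.mem_univ _)), rfl⟩
  have hD : ∀ s ∈ (Finset.univ : Finset ι).powersetCard r,
      (D s).card ≤ Nat.card W ^ r * Nat.card F ^ (r * (Fintype.card ι - r)) := by
    intro s hs
    have hsr := (Finset.mem_powersetCard.1 hs).2
    let ψ : (s → W) × ({i // i ∉ s} → s → F) → ι → W := fun x i =>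
      if h : i ∈ s then x.1 ⟨i, h⟩ else ∑ j, x.2 ⟨i, h⟩ j • x.1 j
    have hψ : D s ⊆ Finset.univ.image ψ := by
      intro v hv
      simp only [D, Finset.mem_filter, Finset.mem_univ, true_and] at hv
      have hc : ∀ i, ∃ c : s → F, ∑ j, c j • v j = v i := by
        intro i
        have hi := hv i
        rw [Set.image_eq_range] at hi
        exact (Submodule.mem_span_range_iff_exists_fun F).1 hi
      choose c hc using hc
      refine Finset.mem_image.2 ⟨(fun j => v j, fun i => c i), Finset.mem_univ _, ?_⟩
      ext i
      simp only [ψ]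
      split_ifs with h
      · rfl
      · exact hc i
    refine (Finset.card_le_card hψ).trans (Finset.card_image_le.trans (le_of_eq ?_))
    rw [Finset.card_univ, Fintype.card_prod, Fintype.card_fun, Fintype.card_fun, Fintype.card_fun,
      Fintype.card_coe, hsr, Fintype.card_subtype_compl, Fintype.card_coe, hsr, ← pow_mul,
      Nat.card_eq_fintype_card, Nat.card_eq_fintype_card]
  calc _ ≤ Nat.card ((Finset.univ.powersetCard r).biUnion D : Finset (ι → W)) :=
        Nat.card_mono (Finset.finite_toSet _) hsub
    _ ≤ _ := by
        rw [Nat.card_eq_fintype_card, Fintype.card_coe]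
        refine (Finset.card_biUnion_le_card_mul _ _ _ hD).trans (le_of_eq ?_)
        rw [Finset.card_powersetCard, Finset.card_univ]

/-- The graphs of three linear maps span a space of dimension at least that of the domain plus
that of the span of the ranges of the differences. -/
lemma finrank_add_le_finrank_sup_graph {F V W : Type*} [Field F] [AddCommGroup V] [Module F V]
    [AddCommGroup W] [Module F W] [FiniteDimensional F V] [FiniteDimensional F W]
    (a b c : V →ₗ[F] W) :
    finrank F V + finrank F ↥(LinearMap.range (a - b) ⊔ LinearMap.range (a - c)) ≤
      finrank F ↥(a.graph ⊔ b.graph ⊔ c.graph) := by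
  set R := LinearMap.range (a - b) ⊔ LinearMap.range (a - c) with hR
  have hdisj : a.graph ⊓ R.map (LinearMap.inr F V W) = ⊥ := by
    rw [eq_bot_iff]
    rintro ⟨x, y⟩ ⟨h1, z, -, h2⟩
    simp only [LinearMap.inr_apply, Prod.mk.injEq] at h2
    have h3 : y = a x := h1
    simp [h3, ← h2.1]
  have hsum := Submodule.finrank_sup_add_finrank_inf_eq a.graph (R.map (LinearMap.inr F V W))
  have hgraph : finrank F a.graph = finrank F V := by
    rw [LinearMap.graph_eq_range_prod]
    exact LinearMap.finrank_range_of_inj fun x y h => (Prod.mk.inj h).1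
  rw [hdisj, finrank_bot, add_zero, hgraph,
    (Submodule.equivMapOfInjective _ LinearMap.inr_injective R).finrank_eq.symm] at hsum
  rw [← hsum]
  apply Submodule.finrank_mono
  have key : ∀ d : V →ₗ[F] W, (LinearMap.range (a - d)).map (LinearMap.inr F V W) ≤
      a.graph ⊔ d.graph := by
    rintro d _ ⟨_, ⟨x, rfl⟩, rfl⟩
    have h1 : (x, a x) ∈ a.graph ⊔ d.graph := Submodule.mem_sup_left rfl
    have h2 : (x, d x) ∈ a.graph ⊔ d.graph := Submodule.mem_sup_right rfl
    simpa using Submodule.sub_mem _ h1 h2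
  rw [hR, Submodule.map_sup]
  refine sup_le (le_sup_left.trans le_sup_left) (sup_le ((key b).trans le_sup_left) ?_)
  exact (key c).trans (sup_le (le_sup_left.trans le_sup_left) le_sup_right)

/-- There are at most `q ^ (3 t ^ 2)` pairs of `t`-tuples of vectors in a space with `q ^ (2 t)`
elements such that the first tuple vanishes or the two together have rank less than `t`. -/
lemma card_degenerate_pairs_le {F W : Type*} [Field F] [Fintype F] [AddCommGroup W] [Module F W]
    [Fintype W] (t : ℕ) (ht : 1 ≤ t) (hW : Nat.card W = Nat.card F ^ (2 * t)) :
    Nat.card {p : (Fin t → W) × (Fin t → W) | p.1 = 0 ∨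
      finrank F ↥(Submodule.span F (Set.range p.1) ⊔ Submodule.span F (Set.range p.2)) < t} ≤
      Nat.card F ^ (3 * t ^ 2) := by
  have hq : 2 ≤ Nat.card F := Finite.one_lt_card
  obtain ⟨s, rfl⟩ := Nat.exists_eq_add_of_le' ht
  set t := s + 1
  let A : Set ((Fin t → W) × (Fin t → W)) := Set.range fun y => (0, y)
  let R : Set (Fin t ⊕ Fin t → W) := {v | finrank F (Submodule.span F (Set.range v)) ≤ s}
  let C : Set ((Fin t → W) × (Fin t → W)) := Equiv.sumArrowEquivProdArrow _ _ _ '' R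
  have hsub : {p : (Fin t → W) × (Fin t → W) | p.1 = 0 ∨
      finrank F ↥(Submodule.span F (Set.range p.1) ⊔ Submodule.span F (Set.range p.2)) < t} ⊆
      A ∪ C := by
    rintro ⟨x, y⟩ (h | h)
    · exact Or.inl ⟨y, by simp_all⟩
    · refine Or.inr ⟨Sum.elim x y, ?_, rfl⟩
      change finrank F (Submodule.span F (Set.range (Sum.elim x y))) ≤ s
      rw [Set.Sum.elim_range, Submodule.span_union]
      exact Nat.lt_succ_iff.1 h
  have hA : Nat.card A ≤ Nat.card F ^ (3 * t ^ 2 - 1) := by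
    refine (Finite.card_range_le _).trans ?_
    rw [Nat.card_fun, Nat.card_fin, hW, ← pow_mul]
    apply Nat.pow_le_pow_right (by omega)
    have : 1 ≤ t ^ 2 := Nat.one_le_pow _ _ ht
    have : 2 * t * t = 2 * t ^ 2 := by ring
    omega
  have hC : Nat.card C ≤ Nat.card F ^ (3 * t ^ 2 - 1) := by
    have h1 := card_finrank_span_le (F := F) (W := W) (ι := Fin t ⊕ Fin t) s (by simp; omega)
    have h2 : Nat.card C = Nat.card R := Nat.card_image_of_injective (Equiv.injective _) R
    rw [h2]
    refine h1.trans ?_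
    simp only [Fintype.card_sum, Fintype.card_fin]
    calc _ ≤ Nat.card F ^ (t + t) *
          ((Nat.card F ^ (2 * t)) ^ s * Nat.card F ^ (s * (t + t - s))) := by
          rw [hW]
          gcongr
          exact (Nat.choose_le_two_pow _ _).trans (Nat.pow_le_pow_left hq _)
      _ = _ := by
          rw [← pow_mul, ← pow_add, ← pow_add]
          congr 1
          have h3 : t + t - s = s + 2 := by omega
          have h4 : 3 * t ^ 2 = 3 * s ^ 2 + 6 * s + 2 + 1 := by simp only [t]; ring
          rw [h3, h4, Nat.add_sub_cancel]
          ring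
  calc _ ≤ Nat.card (A ∪ C : Set _) := Nat.card_mono (Set.toFinite _) hsub
    _ ≤ Nat.card A + Nat.card C := by
        simpa only [Nat.card_coe_set_eq] using Set.ncard_union_le A C
    _ ≤ 2 * Nat.card F ^ (3 * t ^ 2 - 1) := by omega
    _ ≤ Nat.card F * Nat.card F ^ (3 * t ^ 2 - 1) := by gcongr
    _ = _ := by
        rw [← pow_succ', Nat.sub_add_cancel (Nat.one_le_iff_ne_zero.2 (by positivity))]

lemma ceil_mul_sub_one_mul_sub_two_lt {q n : ℕ} (hq : 2 ≤ q) :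
    ⌈(q : ℝ) ^ ((n : ℝ) / 3)⌉₊ * (⌈(q : ℝ) ^ ((n : ℝ) / 3)⌉₊ - 1) *
      (⌈(q : ℝ) ^ ((n : ℝ) / 3)⌉₊ - 2) < q ^ n := by
  set x := (q : ℝ) ^ ((n : ℝ) / 3) with hx
  have hx0 : 0 < x := Real.rpow_pos_of_pos (by positivity) _
  have hx3 : x ^ 3 = (q : ℝ) ^ n := by
    rw [hx, ← Real.rpow_natCast, ← Real.rpow_mul (by positivity), ← Real.rpow_natCast]
    congr 1
    push_cast
    ring
  have hN : (⌈x⌉₊ : ℝ) < x + 1 := Nat.ceil_lt_add_one hx0.le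
  rcases Nat.lt_or_ge ⌈x⌉₊ 2 with h | h
  · rw [show ⌈x⌉₊ - 2 = 0 by omega, mul_zero]
    positivity
  obtain ⟨m, hm⟩ := Nat.exists_eq_add_of_le' h
  rw [hm] at hN ⊢
  rw [show m + 2 - 1 = m + 1 by omega, Nat.add_sub_cancel]
  have h1 : ((m + 1 : ℕ) : ℝ) ^ 3 < (q : ℝ) ^ n := by
    rw [← hx3]
    push_cast at hN ⊢
    exact pow_lt_pow_left₀ (by linarith) (by positivity) (by norm_num)
  have h2 : (m + 1) ^ 3 < q ^ n := by exact_mod_cast h1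
  nlinarith



/-- Let `q` be a prime power (realized as the cardinality of a finite field `F`) and
`t ≥ 1`.  There exists a set `S` of `t`-dimensional subspaces of `F_q^{3t}` with
`|S| ≥ q^{t²/3}` (as a real-number inequality) such that any three distinct subspaces
in `S` together span a subspace of `F_q^{3t}` of dimension at least `2t`. -/
theorem exists_large_family_three_span_2t
    (F : Type*) [Field F] [Fintype F] (t : ℕ) (ht : 1 ≤ t) :
    ∃ S : Set (Submodule F (Fin (3 * t) → F)),
      (∀ U ∈ S, Module.finrank F ↥U = t) ∧
      ((Fintype.card F : ℝ) ^ (((t : ℝ) ^ 2) / 3) ≤ (Nat.card S : ℝ)) ∧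
      (∀ U ∈ S, ∀ V ∈ S, ∀ W ∈ S, U ≠ V → U ≠ W → V ≠ W →
        2 * t ≤ Module.finrank F ↥(U ⊔ V ⊔ W)) := by
  classical
  let V := Fin t → F
  let W := Fin (2 * t) → F
  have hq : 2 ≤ Fintype.card F := Fintype.one_lt_card
  have hW : Nat.card W = Nat.card F ^ (2 * t) := by simp [W]
  let e : (V × W) ≃ₗ[F] (Fin (3 * t) → F) := LinearEquiv.ofFinrankEq _ _ (by
    simp only [V, W, finrank_prod, finrank_fin_fun]
    ring)
  have : Nonempty (Fin t) := ⟨⟨0, ht⟩⟩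
  have : Nonempty (Fin (2 * t)) := ⟨⟨0, by omega⟩⟩
  obtain ⟨f, hinj, hf⟩ := exists_injective_forall_sub_notMem (G := Fin t → W)
    ⌈(Fintype.card F : ℝ) ^ (((t ^ 2 : ℕ) : ℝ) / 3)⌉₊
    {p | p.1 = 0 ∨ finrank F
      ↥(Submodule.span F (Set.range p.1) ⊔ Submodule.span F (Set.range p.2)) < t}
    (fun _ => Or.inl rfl) (by
      refine (Nat.mul_le_mul_left _ (card_degenerate_pairs_le t ht hW)).trans_lt ?_
      refine (Nat.mul_lt_mul_of_pos_right (ceil_mul_sub_one_mul_sub_two_lt hq)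
        (pow_pos Nat.card_pos _)).trans_le (le_of_eq ?_)
      rw [Nat.card_fun, hW, Nat.card_fin, Nat.card_eq_fintype_card, ← pow_add, ← pow_mul,
        ← pow_mul]
      congr 1
      ring)
  let L : (Fin t → W) → V →ₗ[F] W := fun a => Fintype.linearCombination F a
  have hLsub : ∀ a b, LinearMap.range (L a - L b) = Submodule.span F (Set.range (a - b)) := by
    intro a b
    rw [← Fintype.range_linearCombination]
    congr 1
    ext x
    simp [L, Fintype.linearCombination_apply]
  have hLinj : Function.Injective L := by
    intro a b h
    ext1 i
    have := LinearMap.congr_fun h (Pi.single i 1)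
    have hone : ∀ c : Fin t → W, L c (Pi.single i 1) = c i := fun c => by
      rw [Fintype.linearCombination_apply_single, one_smul]
    rwa [hone, hone] at this
  let U : Fin _ → Submodule F (Fin (3 * t) → F) := fun i => (L (f i)).graph.map e.toLinearMap
  have hU : Function.Injective U := by
    intro i j h
    have hg : (L (f i)).graph = (L (f j)).graph :=
      Submodule.map_injective_of_injective e.injective h
    refine hinj (hLinj (LinearMap.ext fun x => ?_))
    exact (hg.le rfl : (x, L (f i) x) ∈ (L (f j)).graph)
  have hmap : ∀ Z : Submodule F (V × W), finrank F (Z.map e.toLinearMap) = finrank F Z :=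
    fun Z => LinearEquiv.finrank_map_eq e Z
  refine ⟨Set.range U, ?_, ?_, ?_⟩
  · rintro _ ⟨i, rfl⟩
    rw [hmap, LinearMap.graph_eq_range_prod,
      LinearMap.finrank_range_of_inj fun x y h => (Prod.mk.inj h).1, finrank_fin_fun]
  · rw [Nat.card_range_of_injective hU, Nat.card_fin, ← Nat.cast_pow]
    exact Nat.le_ceil _
  · rintro _ ⟨i, rfl⟩ _ ⟨j, rfl⟩ _ ⟨k, rfl⟩ hij hik hjk
    have h := hf i j k (ne_of_apply_ne U hij) (ne_of_apply_ne U hik) (ne_of_apply_ne U hjk)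
    simp only [Set.mem_ofPred_eq, not_or, not_lt] at h
    have h2 := finrank_add_le_finrank_sup_graph (L (f i)) (L (f j)) (L (f k))
    rw [hLsub, hLsub, finrank_fin_fun] at h2
    rw [← Submodule.map_sup, ← Submodule.map_sup, hmap]
    omega
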